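/- arXiv:2410.20767 — 3 statements merged into one kernel-verified Lean document; each statement's English description precedes it below -/
import Mathlib

section
/- (Károlyi's inverse theorem) Let p be a prime and let A and B be subsets of F = ℤ/pℤ with p > |A| + |B| − 3, |A| ≥ 5 and |B| ≥ 5. Then |A ∔ B| = |A| + |B| − 3 if and only if A = B and A is an arithmetic progression with nonzero common difference. -/
/-- `S` is an arithmetic progression in `ℤ/pℤ` with common difference `d`,
i.e. a set of the form `{x, x + d, x + 2d, …, x + (m−1)d}`. -/
def IsAPWithDiff {p : ℕ} (S : Finset (ZMod p)) (d : ZMod p) : Prop :=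
  ∃ x : ZMod p, ∃ m : ℕ, S = (Finset.range m).image fun j : ℕ => x + (j : ZMod p) * d

section

open Finset Polynomial

/-- The coefficient of `x ^ s * y ^ (t + 1 - s)` in `(x - y) * (x + y) ^ t`. -/
def antiChoose (t : ℕ) : ℕ → ℤ
  | 0 => -1
  | s + 1 => t.choose s - t.choose (s + 1)

lemma sub_mul_add_pow {R : Type*} [CommRing R] (a b : R) (t : ℕ) :
    (a - b) * (a + b) ^ t
      = ∑ s ∈ range (t + 2), (antiChoose t s : R) * a ^ s * b ^ (t + 1 - s) := by
  have h1 : a * (a + b) ^ t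
      = ∑ s ∈ range (t + 1), (t.choose s : R) * a ^ (s + 1) * b ^ (t - s) := by
    rw [add_pow, mul_sum]
    exact sum_congr rfl fun s _ => by ring
  have h2 : b * (a + b) ^ t
      = ∑ s ∈ range (t + 1), (t.choose (s + 1) : R) * a ^ (s + 1) * b ^ (t - s)
        + b ^ (t + 1) := by
    rw [add_pow, mul_sum, sum_range_succ', sum_range_succ _ t]
    simp only [Nat.choose_succ_self, Nat.cast_zero, zero_mul, add_zero]
    congr 1
    · refine sum_congr rfl fun s hs => ?_
      have hst : t - s = t - (s + 1) + 1 := by have := mem_range.1 hs; omega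
      rw [hst]; ring
    · simp [pow_succ']
  rw [sub_mul, h1, h2, sum_range_succ' _ (t + 1), ← sub_sub, ← sum_sub_distrib]
  simp only [antiChoose, Nat.add_sub_add_right]
  push_cast
  simp only [pow_zero, mul_one, neg_mul, one_mul, sub_eq_add_neg]
  congr 1
  exact sum_congr rfl fun s _ => by ring

lemma antiChoose_mul_factorial {n a b : ℕ} (h : a + b = n + 1) :
    antiChoose n a * a.factorial * b.factorial = n.factorial * ((a : ℤ) - b) := by
  obtain _ | a := a
  · obtain rfl : b = n + 1 := by omega
    simp [antiChoose, Nat.factorial_succ]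
    ring
  obtain _ | b := b
  · obtain rfl : a = n := by omega
    simp [antiChoose, Nat.factorial_succ]
    ring
  have h1 := Nat.choose_mul_factorial_mul_factorial (show a ≤ n by omega)
  have h2 := Nat.choose_mul_factorial_mul_factorial (show a + 1 ≤ n by omega)
  rw [show n - a = b + 1 by omega] at h1
  rw [show n - (a + 1) = b by omega] at h2
  zify at h1 h2
  simp only [antiChoose, Nat.factorial_succ] at *
  push_cast at *
  linear_combination ((a : ℤ) + 1) * h1 - ((b : ℤ) + 1) * h2

variable {K : Type*} [Field K] [DecidableEq K]

/-- The sum of `a ^ n / g'(a)` over the roots `a` of `g = ∏ a ∈ A, (X - a)`. -/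
def nodalMoment (A : Finset K) (n : ℕ) : K :=
  ∑ a ∈ A, a ^ n / ∏ b ∈ A.erase a, (a - b)

lemma nodalMoment_eq_zero {A : Finset K} {n : ℕ} (h : n + 1 < #A) : nodalMoment A n = 0 := by
  have := Lagrange.coeff_eq_sum (s := A) (v := id) Function.injective_id.injOn
    (P := (X ^ n : K[X])) (by rw [degree_X_pow]; exact_mod_cast (by omega : n < #A))
  rw [coeff_X_pow, if_neg (by omega)] at this
  simpa [nodalMoment] using this.symm

lemma nodalMoment_eq_one {A : Finset K} {n : ℕ} (h : n + 1 = #A) : nodalMoment A n = 1 := by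
  have := Lagrange.coeff_eq_sum (s := A) (v := id) Function.injective_id.injOn
    (P := (X ^ n : K[X])) (by rw [degree_X_pow]; exact_mod_cast (by omega : n < #A))
  rw [coeff_X_pow, if_pos (by omega)] at this
  simpa [nodalMoment] using this.symm

lemma sum_coeff_mul_nodalMoment {A : Finset K} {g : K[X]} (hg : ∀ a ∈ A, g.eval a = 0) {L : ℕ}
    (hL : g.natDegree < L) (n : ℕ) :
    ∑ j ∈ range L, g.coeff j * nodalMoment A (n + j) = 0 := by
  simp only [nodalMoment, mul_sum]
  rw [sum_comm]
  refine sum_eq_zero fun a ha => ?_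
  have := hg a ha
  rw [eval_eq_sum_range' hL] at this
  calc _ = (a ^ n / ∏ b ∈ A.erase a, (a - b)) * ∑ j ∈ range L, g.coeff j * a ^ j := by
        rw [mul_sum]; exact sum_congr rfl fun j _ => by ring
    _ = 0 := by rw [this, mul_zero]

lemma sum_antiChoose_mul_nodalMoment {A B : Finset K} {c : K[X]}
    (hc : ∀ a ∈ A, ∀ b ∈ B, (a - b) * c.eval (a + b) = 0) {L : ℕ} (hL : c.natDegree < L)
    (i j : ℕ) :
    ∑ t ∈ range L, ∑ s ∈ range (t + 2), (antiChoose t s : K) * c.coeff t *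
      nodalMoment A (i + s) * nodalMoment B (j + (t + 1 - s)) = 0 := by
  set wA : K → K := fun a => ∏ b ∈ A.erase a, (a - b)
  set wB : K → K := fun a => ∏ b ∈ B.erase a, (a - b)
  have key : ∀ a ∈ A, ∀ b ∈ B, ∑ t ∈ range L, ∑ s ∈ range (t + 2),
      (antiChoose t s : K) * c.coeff t * (a ^ (i + s) / wA a)
        * (b ^ (j + (t + 1 - s)) / wB b) = 0 := by
    intro a ha b hb
    calc _ = a ^ i / wA a * (b ^ j / wB b) * ((a - b) * c.eval (a + b)) := by
          rw [eval_eq_sum_range' hL, mul_sum, mul_sum]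
          refine sum_congr rfl fun t _ => ?_
          rw [mul_left_comm (a - b), sub_mul_add_pow, mul_sum, mul_sum]
          exact sum_congr rfl fun s _ => by ring
      _ = 0 := by rw [hc a ha b hb, mul_zero]
  calc _ = ∑ t ∈ range L, ∑ s ∈ range (t + 2), ∑ a ∈ A, ∑ b ∈ B,
      (antiChoose t s : K) * c.coeff t * (a ^ (i + s) / wA a)
        * (b ^ (j + (t + 1 - s)) / wB b) := by
        refine sum_congr rfl fun t _ => sum_congr rfl fun s _ => ?_
        simp only [nodalMoment, mul_assoc, sum_mul_sum]
        simp only [mul_sum]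
        rfl
    _ = ∑ a ∈ A, ∑ b ∈ B, ∑ t ∈ range L, ∑ s ∈ range (t + 2),
      (antiChoose t s : K) * c.coeff t * (a ^ (i + s) / wA a)
        * (b ^ (j + (t + 1 - s)) / wB b) := by
        simp only [sum_comm (s := range (_ + 2)) (t := A), sum_comm (s := range L) (t := A),
          sum_comm (s := range (_ + 2)) (t := B), sum_comm (s := range L) (t := B)]
    _ = 0 := sum_eq_zero fun a ha => sum_eq_zero fun b hb => key a ha b hb

/-- If `(x - y) * c (x + y)` vanishes on `A × B`, where `c` is monic of degree
`|A| + |B| - 3`, then `|A| = |B|` in the ground field, up to a factorial. -/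
lemma factorial_mul_card_sub_card_eq_zero {A B : Finset K} {c : K[X]}
    (hc : ∀ a ∈ A, ∀ b ∈ B, (a - b) * c.eval (a + b) = 0) (hmon : c.Monic) {m n : ℕ}
    (hA : #A = m + 1) (hB : #B = n + 2) (hdeg : c.natDegree = m + n) :
    ((m + n).factorial : K) * ((m : K) - (n + 1)) = 0 := by
  have h := sum_antiChoose_mul_nodalMoment hc (L := m + n + 1) (by omega) 0 0
  rw [sum_eq_single (m + n), sum_eq_single m] at h
  · have h3 := antiChoose_mul_factorial (n := m + n) (a := m) (b := n + 1) (by omega)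
    have h4 := congrArg (Int.cast : ℤ → K) h3
    push_cast at h4
    rw [nodalMoment_eq_one (by omega), nodalMoment_eq_one (by omega), ← hdeg,
      hmon.coeff_natDegree, hdeg] at h
    rw [← h4]
    linear_combination (m.factorial : K) * (n + 1).factorial * h
  · intro s hs hsm
    rcases lt_or_gt_of_ne hsm with hlt | hlt
    · rw [nodalMoment_eq_zero (A := A) (by omega)]; ring
    · rw [nodalMoment_eq_zero (A := B) (by omega)]; ring
  · intro hh; exact absurd (mem_range.2 (by omega)) hh
  · intro t ht htm
    have := mem_range.1 ht
    refine sum_eq_zero fun s hs => ?_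
    have := mem_range.1 hs
    rcases lt_or_ge s m with hlt | hlt
    · rw [nodalMoment_eq_zero (A := A) (by omega)]; ring
    · rw [nodalMoment_eq_zero (A := B) (by omega)]; ring
  · intro hh; exact absurd (mem_range.2 (by omega)) hh


/-- The relations between the moments `α`, `β` of two `(m + 1)`-element sets and the coefficients
`γ` of a monic polynomial `c` of degree `2 * m - 1` which express that
`(x - y) * c (x + y)` vanishes on the product of the two sets. -/
structure IsMomentSystem (m : ℕ) (α β γ : ℕ → K) : Prop where
  left_eq_zero : ∀ n < m, α n = 0
  right_eq_zero : ∀ n < m, β n = 0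
  left_eq_one : α m = 1
  right_eq_one : β m = 1
  coeff_eq_one : γ (2 * m - 1) = 1
  sum_eq_zero : ∀ i j, ∑ t ∈ range (2 * m), ∑ s ∈ range (t + 2),
    (antiChoose t s : K) * γ t * α (i + s) * β (j + (t + 1 - s)) = 0

omit [DecidableEq K] in
lemma IsMomentSystem.scale {m : ℕ} {α β γ : ℕ → K} (h : IsMomentSystem m α β γ) (d : K) :
    IsMomentSystem m (fun n => d ^ (n - m) * α n) (fun n => d ^ (n - m) * β n)
      (fun t => d ^ (2 * m - 1 - t) * γ t) where
  left_eq_zero n hn := by rw [h.left_eq_zero n hn, mul_zero]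
  right_eq_zero n hn := by rw [h.right_eq_zero n hn, mul_zero]
  left_eq_one := by simp [h.left_eq_one]
  right_eq_one := by simp [h.right_eq_one]
  coeff_eq_one := by simp [h.coeff_eq_one]
  sum_eq_zero i j := by
    rw [← mul_zero (d ^ (i + j)), ← h.sum_eq_zero i j, mul_sum]
    refine sum_congr rfl fun t ht => ?_
    rw [mul_sum]
    refine sum_congr rfl fun s hs => ?_
    have ht := mem_range.1 ht
    have hs := mem_range.1 hs
    rcases lt_or_ge (i + s) m with h1 | h1
    · rw [h.left_eq_zero _ h1]; ring
    rcases lt_or_ge (j + (t + 1 - s)) m with h2 | h2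
    · rw [h.right_eq_zero _ h2]; ring
    have : i + j = (2 * m - 1 - t) + (i + s - m) + (j + (t + 1 - s) - m) := by omega
    rw [this, pow_add, pow_add]
    ring

omit [DecidableEq K] in
/-- If two systems of moments agree below level `i + j`, then their differences at that level
satisfy a linear relation. -/
lemma IsMomentSystem.linear_relation {m : ℕ} {α β γ α' β' γ' : ℕ → K}
    (h : IsMomentSystem m α β γ) (h' : IsMomentSystem m α' β' γ') {i j : ℕ}
    (hi : i ≤ m) (hj : j ≤ m) (hN : 0 < i + j) (hN' : i + j < 2 * m)
    (hα : ∀ n < m + (i + j), α n = α' n) (hβ : ∀ n < m + (i + j), β n = β' n)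
    (hγ : ∀ t < 2 * m, 2 * m < t + 1 + (i + j) → γ t = γ' t) :
    (antiChoose (2 * m - 1 - (i + j)) (m - i) : K)
        * (γ (2 * m - 1 - (i + j)) - γ' (2 * m - 1 - (i + j)))
      + (antiChoose (2 * m - 1) (m + j) : K) * (α (m + (i + j)) - α' (m + (i + j)))
      + (antiChoose (2 * m - 1) (m - i) : K) * (β (m + (i + j)) - β' (m + (i + j))) = 0 := by
  have key : ∀ t ∈ range (2 * m), ∀ s ∈ range (t + 2),
      (antiChoose t s : K) * γ t * α (i + s) * β (j + (t + 1 - s))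
        - (antiChoose t s : K) * γ' t * α' (i + s) * β' (j + (t + 1 - s))
      = (if t = 2 * m - 1 - (i + j) then (if s = m - i then
          (antiChoose t s : K) * (γ t - γ' t) else 0) else 0)
      + (if t = 2 * m - 1 then (if s = m + j then
          (antiChoose t s : K) * (α (m + (i + j)) - α' (m + (i + j))) else 0) else 0)
      + (if t = 2 * m - 1 then (if s = m - i then
          (antiChoose t s : K) * (β (m + (i + j)) - β' (m + (i + j))) else 0) else 0) := by
    intro t ht s hs
    have ht := mem_range.1 ht
    have hs := mem_range.1 hs
    rcases lt_or_ge (i + s) m with h1 | h1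
    · rw [h.left_eq_zero _ h1, h'.left_eq_zero _ h1, if_neg (show s ≠ m - i by omega),
        if_neg (show s ≠ m + j by omega), if_neg (show s ≠ m - i by omega)]
      simp
    rcases lt_or_ge (j + (t + 1 - s)) m with h2 | h2
    · rw [h.right_eq_zero _ h2, h'.right_eq_zero _ h2]
      have e1 : ¬ (t = 2 * m - 1 - (i + j) ∧ s = m - i) := by omega
      have e2 : ¬ (t = 2 * m - 1 ∧ s = m + j) := by omega
      have e3 : ¬ (t = 2 * m - 1 ∧ s = m - i) := by omega
      simp only [← ite_and, if_neg e1, if_neg e2, if_neg e3]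
      simp
    by_cases c1 : t = 2 * m - 1 - (i + j) ∧ s = m - i
    · have e2 : ¬ (t = 2 * m - 1 ∧ s = m + j) := by omega
      have e3 : ¬ (t = 2 * m - 1 ∧ s = m - i) := by omega
      have e4 : i + s = m := by omega
      have e5 : j + (t + 1 - s) = m := by omega
      simp only [← ite_and, if_neg e2, if_neg e3, if_pos c1]
      rw [e4, e5, h.left_eq_one, h'.left_eq_one, h.right_eq_one, h'.right_eq_one]
      ring
    by_cases c2 : t = 2 * m - 1 ∧ s = m + j
    · have e3 : ¬ (t = 2 * m - 1 ∧ s = m - i) := by omega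
      have e4 : i + s = m + (i + j) := by omega
      have e5 : j + (t + 1 - s) = m := by omega
      simp only [← ite_and, if_neg c1, if_neg e3, if_pos c2]
      rw [e4, e5, c2.1, h.coeff_eq_one, h'.coeff_eq_one, h.right_eq_one, h'.right_eq_one]
      ring
    by_cases c3 : t = 2 * m - 1 ∧ s = m - i
    · have e4 : i + s = m := by omega
      have e5 : j + (t + 1 - s) = m + (i + j) := by omega
      simp only [← ite_and, if_neg c1, if_neg c2, if_pos c3]
      rw [e4, e5, c3.1, h.coeff_eq_one, h'.coeff_eq_one, h.left_eq_one, h'.left_eq_one]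
      ring
    simp only [← ite_and, if_neg c1, if_neg c2, if_neg c3]
    rw [hα _ (by omega), hβ _ (by omega), hγ t ht (by omega)]
    ring
  have hsub : (0 : K) = 0 - 0 := (sub_zero 0).symm
  conv_rhs => rw [hsub]
  conv_rhs =>
    congr
    · rw [← h.sum_eq_zero i j]
    · rw [← h'.sum_eq_zero i j]
  simp only [← sum_sub_distrib]
  rw [sum_congr rfl fun t ht => sum_congr rfl (key t ht)]
  simp only [sum_add_distrib]
  congr 1
  · congr 1
    · rw [sum_eq_single (2 * m - 1 - (i + j)), sum_eq_single (m - i)]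
      · simp
      · intro s _ hs; simp [hs]
      · intro hh; exact absurd (mem_range.2 (by omega)) hh
      · intro t _ ht; simp [ht]
      · intro hh; exact absurd (mem_range.2 (by omega)) hh
    · rw [sum_eq_single (2 * m - 1), sum_eq_single (m + j)]
      · simp
      · intro s _ hs; simp [hs]
      · intro hh; exact absurd (mem_range.2 (by omega)) hh
      · intro t _ ht; simp [ht]
      · intro hh; exact absurd (mem_range.2 (by omega)) hh
  · rw [sum_eq_single (2 * m - 1), sum_eq_single (m - i)]
    · simp
    · intro s _ hs; simp [hs]
    · intro hh; exact absurd (mem_range.2 (by omega)) hh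
    · intro t _ ht; simp [ht]
    · intro hh; exact absurd (mem_range.2 (by omega)) hh

lemma isMomentSystem_of_eval_eq_zero {A B : Finset K} {c : K[X]} {m : ℕ} (hm : 0 < m)
    (hc : ∀ a ∈ A, ∀ b ∈ B, (a - b) * c.eval (a + b) = 0) (hmon : c.Monic)
    (hA : #A = m + 1) (hB : #B = m + 1) (hdeg : c.natDegree = 2 * m - 1) :
    IsMomentSystem m (nodalMoment A) (nodalMoment B) c.coeff where
  left_eq_zero n hn := nodalMoment_eq_zero (by omega)
  right_eq_zero n hn := nodalMoment_eq_zero (by omega)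
  left_eq_one := nodalMoment_eq_one (by omega)
  right_eq_one := nodalMoment_eq_one (by omega)
  coeff_eq_one := by rw [← hdeg]; exact hmon
  sum_eq_zero := sum_antiChoose_mul_nodalMoment hc (by omega)

section LevelRelations

omit [DecidableEq K]

lemma natCast_ne_zero_of_factorial {n k : ℕ} (h : (n.factorial : K) ≠ 0) (hk : 0 < k)
    (hkn : k ≤ n) : (k : K) ≠ 0 := by
  intro h0
  obtain ⟨r, hr⟩ := Nat.dvd_factorial hk hkn
  rw [hr, Nat.cast_mul, h0, zero_mul] at h
  exact h rfl

lemma natCast_factorial_ne_zero_of_le {n k : ℕ} (h : (n.factorial : K) ≠ 0) (hkn : k ≤ n) :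
    (k.factorial : K) ≠ 0 := by
  intro h0
  obtain ⟨r, hr⟩ := Nat.factorial_dvd_factorial hkn
  rw [hr, Nat.cast_mul, h0, zero_mul] at h
  exact h rfl

lemma natCast_factorial_eq {a b : ℕ} {x : K} (h : a = b + 1) (hx : (a : K) = x) :
    (a.factorial : K) = x * b.factorial := by
  rw [← hx, h, Nat.factorial_succ, Nat.cast_mul]

/-- The relations between the differences of moments at level `N = i + j`, after clearing
denominators. -/
def LevelRelation (m : ℕ) (u v w : K) (i j : ℕ) : Prop :=
  ((j : K) - i) * (m + i).factorial * (m + j).factorial * w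
    + j * (m - i).factorial * (m + i).factorial * u
    - i * (m - j).factorial * (m + j).factorial * v = 0

lemma levelRelation_zero_left {m N : ℕ} (hF : ((2 * m).factorial : K) ≠ 0) (hN : 0 < N)
    (hNm : N ≤ m) {u v w : K} (h : LevelRelation m u v w 0 N) :
    (m + N).factorial * w + m.factorial * u = 0 := by
  have h1 : (N : K) ≠ 0 := natCast_ne_zero_of_factorial hF hN (by omega)
  have h2 : (m.factorial : K) ≠ 0 := natCast_factorial_ne_zero_of_le hF (by omega)
  simp only [LevelRelation, Nat.add_zero, Nat.sub_zero, Nat.cast_zero] at h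
  have : (N : K) * m.factorial * ((m + N).factorial * w + m.factorial * u) = 0 := by
    linear_combination h
  exact (mul_eq_zero.1 this).resolve_left (mul_ne_zero h1 h2)

lemma levelRelation_zero_right {m N : ℕ} (hF : ((2 * m).factorial : K) ≠ 0) (hN : 0 < N)
    (hNm : N ≤ m) {u v w : K} (h : LevelRelation m u v w N 0) :
    (m + N).factorial * w + m.factorial * v = 0 := by
  refine levelRelation_zero_left hF hN hNm (v := u) ?_
  simp only [LevelRelation] at h ⊢
  linear_combination -h

lemma eq_zero_of_levelRelation_of_le {m N : ℕ} (hm : 4 ≤ m)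
    (hF : ((2 * m).factorial : K) ≠ 0) (hN : 3 ≤ N) (hNm : N ≤ m) {u v w : K}
    (h : ∀ i j, i ≤ m → j ≤ m → i + j = N → LevelRelation m u v w i j) :
    u = 0 ∧ v = 0 ∧ w = 0 := by
  have nz : ∀ k : ℕ, 0 < k → k ≤ 2 * m → (k : K) ≠ 0 := fun k =>
    natCast_ne_zero_of_factorial hF
  have fz : ∀ k : ℕ, k ≤ 2 * m → (k.factorial : K) ≠ 0 := fun k =>
    natCast_factorial_ne_zero_of_le hF
  have hu := levelRelation_zero_left hF (by omega) hNm (h 0 N (by omega) hNm (by omega))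
  have hv := levelRelation_zero_right hF (by omega) hNm (h N 0 hNm (by omega) (by omega))
  obtain ⟨z, rfl⟩ : ∃ z, w = m.factorial * z :=
    ⟨w / m.factorial, by rw [mul_div_cancel₀ _ (fz m (by omega))]⟩
  obtain rfl : u = -(m + N).factorial * z := by
    apply mul_left_cancel₀ (fz m (by omega)); linear_combination hu
  obtain rfl : v = -(m + N).factorial * z := by
    apply mul_left_cancel₀ (fz m (by omega)); linear_combination hv
  suffices hz : z = 0 by simp [hz]
  have e1 : (m.factorial : K) = m * (m - 1).factorial :=
    natCast_factorial_eq (by omega) rfl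
  have e2 : ((m - 1).factorial : K) = (m - 1) * (m - 2).factorial :=
    natCast_factorial_eq (by omega) (by push_cast [show 1 ≤ m by omega]; ring)
  have e3 : ((m + 1).factorial : K) = (m + 1) * m.factorial :=
    natCast_factorial_eq (by omega) (by push_cast; ring)
  have e4 : ((m + 2).factorial : K) = (m + 2) * (m + 1).factorial :=
    natCast_factorial_eq (by omega) (by push_cast; ring)
  have e5 : ((m + N).factorial : K) = (m + N) * (m + (N - 1)).factorial :=
    natCast_factorial_eq (by omega) (by push_cast; ring)
  have h1 := h 1 (N - 1) (by omega) (by omega) (by omega)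
  have hN1 : ((N - 1 : ℕ) : K) = N - 1 := by push_cast [show 1 ≤ N by omega]; ring
  simp only [LevelRelation, hN1, Nat.cast_one, e3, e1, e5] at h1
  set a := ((m - 1).factorial : K) with ha
  set b := ((m + (N - 1)).factorial : K) with hb
  set q := ((m - (N - 1)).factorial : K) with hq
  have hb0 : b ≠ 0 := fz _ (by omega)
  have ha2 : ((m - 2).factorial : K) ≠ 0 := fz _ (by omega)
  have m0 : (m : K) ≠ 0 := nz m (by omega) (by omega)
  have m1 : (m : K) + 1 ≠ 0 := by exact_mod_cast nz (m + 1) (by omega) (by omega)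
  have m3 : (3 : K) ≠ 0 := by exact_mod_cast nz 3 (by omega) (by omega)
  have m4 : (4 : K) ≠ 0 := by exact_mod_cast nz 4 (by omega) (by omega)
  have m5 : (5 : K) ≠ 0 := by exact_mod_cast nz 5 (by omega) (by omega)
  have mm1 : (m : K) - 1 ≠ 0 := by
    have := nz (m - 1) (by omega) (by omega)
    rwa [Nat.cast_sub (by omega), Nat.cast_one] at this
  have h1' : z * (m * (m + 1) * a ^ 2 * ((N - 2) * m - (N - 1) * (m + N)) + q * b * (m + N))
      = 0 := by
    apply mul_left_cancel₀ hb0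
    linear_combination h1
  obtain rfl | rfl | hN5 : N = 3 ∨ N = 4 ∨ 5 ≤ N := by omega
  · have hb' : b = (m + 2) * ((m + 1) * (m * a)) := by rw [hb, ← e1, ← e3, ← e4]
    have hq' : q = (m - 2).factorial := by rw [hq]
    rw [hb', hq', e2] at h1'
    push_cast at h1'
    have : 3 * 4 * m * (m + 1) * (m - 1) * ((m - 2).factorial : K) ^ 2 * z = 0 := by
      linear_combination h1'
    simpa [m0, m1, m3, m4, mm1, ha2] using this
  · have e6 : ((m + 3).factorial : K) = (m + 3) * (m + 2).factorial :=
      natCast_factorial_eq (by omega) (by push_cast; ring)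
    have e7 : ((m - 2).factorial : K) = (m - 2) * (m - 3).factorial :=
      natCast_factorial_eq (by omega) (by push_cast [show 2 ≤ m by omega]; ring)
    have hb' : b = (m + 3) * ((m + 2) * ((m + 1) * (m * a))) := by
      rw [hb, ← e1, ← e3, ← e4, ← e6]
    have hq' : q = (m - 3).factorial := by rw [hq]
    have ha3 : ((m - 3).factorial : K) ≠ 0 := fz _ (by omega)
    have mm2 : (m : K) - 2 ≠ 0 := by
      have := nz (m - 2) (by omega) (by omega)
      rw [Nat.cast_sub (by omega)] at this
      exact_mod_cast this
    rw [hb', hq', e2, e7] at h1'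
    push_cast at h1'
    have : 3 * 4 * 5 * m * (m * (m + 1) * (m - 1) * (m - 2) * ((m - 3).factorial : K) ^ 2) * z
        = 0 := by
      linear_combination h1'
    simpa [m0, m1, m3, m4, m5, mm1, mm2, ha3] using this
  · have h2 := h 2 (N - 2) (by omega) (by omega) (by omega)
    have hN2 : ((N - 2 : ℕ) : K) = N - 2 := by push_cast [show 2 ≤ N by omega]; ring
    have e6 : b = (m + N - 1) * (m + (N - 2)).factorial :=
      natCast_factorial_eq (by omega) (by push_cast [show 1 ≤ N by omega]; ring)
    have e7 : ((m - (N - 2)).factorial : K) = (m - N + 2) * q := by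
      refine natCast_factorial_eq (by omega) ?_
      rw [Nat.cast_sub (by omega), Nat.cast_sub (by omega)]
      push_cast; ring
    simp only [LevelRelation, hN2, Nat.cast_ofNat, e3, e1, e5, e4, e7] at h2
    have hb2 : ((m + (N - 2)).factorial : K) ≠ 0 := fz _ (by omega)
    have h2' : z * ((N - 4) * (m + 2) * (m + 1) * m ^ 2 * a ^ 2
        - (N - 2) * (m - 2).factorial * a * (m + 2) * (m + 1) * m * (m + N) * (m + N - 1)
        + 2 * (m - N + 2) * q * (m + N) * b) = 0 := by
      apply mul_left_cancel₀ hb2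
      rw [e6] at h2 ⊢
      linear_combination h2
    have z1 : (N : K) ≠ 0 := nz N (by omega) (by omega)
    have z2 : (N : K) - 2 ≠ 0 := by rw [← hN2]; exact nz _ (by omega) (by omega)
    have z3 : (N : K) + 1 ≠ 0 := by exact_mod_cast nz (N + 1) (by omega) (by omega)
    rw [e2] at h2' h1'
    have : 3 * m * (m * (m - 1) * (m + 1)) * N * (N - 2) * (N + 1)
        * ((m - 2).factorial : K) ^ 2 * z = 0 := by
      linear_combination -h2' + 2 * (m - N + 2) * h1'
    simpa [m0, m1, m3, mm1, ha2, z1, z2, z3] using this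

lemma eq_zero_of_levelRelation_succ {m : ℕ} (hm : 4 ≤ m)
    (hF : ((2 * m).factorial : K) ≠ 0) {u v w : K}
    (h : ∀ i j, i ≤ m → j ≤ m → i + j = m + 1 → LevelRelation m u v w i j) :
    u = 0 ∧ v = 0 := by
  have nz : ∀ k : ℕ, 0 < k → k ≤ 2 * m → (k : K) ≠ 0 := fun k =>
    natCast_ne_zero_of_factorial hF
  have fz : ∀ k : ℕ, k ≤ 2 * m → (k.factorial : K) ≠ 0 := fun k =>
    natCast_factorial_ne_zero_of_le hF
  have h1 := h 1 m (by omega) (by omega) (by omega)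
  have h2 := h m 1 (by omega) (by omega) (by omega)
  have h3 := h 2 (m - 1) (by omega) (by omega) (by omega)
  have h4 := h (m - 1) 2 (by omega) (by omega) (by omega)
  have e1 : (m.factorial : K) = m * (m - 1).factorial :=
    natCast_factorial_eq (by omega) rfl
  have e2 : ((m - 1).factorial : K) = (m - 1) * (m - 2).factorial :=
    natCast_factorial_eq (by omega) (by push_cast [show 1 ≤ m by omega]; ring)
  have e3 : ((m + 1).factorial : K) = (m + 1) * m.factorial :=
    natCast_factorial_eq (by omega) (by push_cast; ring)
  have e4 : ((m + 2).factorial : K) = (m + 2) * (m + 1).factorial :=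
    natCast_factorial_eq (by omega) (by push_cast; ring)
  have e5 : ((m + m).factorial : K) = 2 * m * (m + (m - 1)).factorial :=
    natCast_factorial_eq (by omega) (by push_cast; ring)
  have m0 : (m : K) ≠ 0 := nz m (by omega) (by omega)
  have m1 : (m : K) + 1 ≠ 0 := by exact_mod_cast nz (m + 1) (by omega) (by omega)
  have m2 : (m : K) + 2 ≠ 0 := by exact_mod_cast nz (m + 2) (by omega) (by omega)
  have t2 : (2 : K) ≠ 0 := by exact_mod_cast nz 2 (by omega) (by omega)
  have t3 : (3 : K) ≠ 0 := by exact_mod_cast nz 3 (by omega) (by omega)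
  have t7 : (7 : K) ≠ 0 := by exact_mod_cast nz 7 (by omega) (by omega)
  have mm1 : (m : K) - 1 ≠ 0 := by
    have := nz (m - 1) (by omega) (by omega)
    rwa [Nat.cast_sub (by omega), Nat.cast_one] at this
  have hm1 : ((m - 1 : ℕ) : K) = m - 1 := by push_cast [show 1 ≤ m by omega]; ring
  have T0 : ((m + m).factorial : K) ≠ 0 := fz _ (by omega)
  have a0 : ((m - 1).factorial : K) ≠ 0 := fz _ (by omega)
  have a20 : ((m - 2).factorial : K) ≠ 0 := fz _ (by omega)
  have T10 : ((m + (m - 1)).factorial : K) ≠ 0 := fz _ (by omega)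
  obtain ⟨σ, hσ⟩ : ∃ σ : K, ((m + m).factorial : K) = σ * ((m + 1) * m.factorial ^ 2) :=
    ⟨(m + m).factorial / ((m + 1) * m.factorial ^ 2), by
      rw [div_mul_cancel₀]
      exact mul_ne_zero m1 (pow_ne_zero _ (fz m (by omega)))⟩
  obtain ⟨x, rfl⟩ : ∃ x, u = (m + m).factorial * x := ⟨u / _, by rw [mul_div_cancel₀ _ T0]⟩
  obtain ⟨y, rfl⟩ : ∃ y, v = (m + m).factorial * y := ⟨v / _, by rw [mul_div_cancel₀ _ T0]⟩
  obtain ⟨z, rfl⟩ : ∃ z, w = m.factorial * z :=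
    ⟨w / m.factorial, by rw [mul_div_cancel₀ _ (fz m (by omega))]⟩
  simp only [LevelRelation, Nat.sub_self, Nat.factorial_zero, Nat.cast_one, e3] at h1 h2
  have r1 : x - σ * y + (m - 1) * z = 0 := by
    apply mul_left_cancel₀ (mul_ne_zero T0 (mul_ne_zero m1 (pow_ne_zero 2 (fz m (by omega)))))
    rw [e1] at *
    linear_combination h1 + ((m + m).factorial : K) * y * hσ
  have r2 : σ * x - y - (m - 1) * z = 0 := by
    apply mul_left_cancel₀ (mul_ne_zero T0 (mul_ne_zero m1 (pow_ne_zero 2 (fz m (by omega)))))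
    rw [e1] at *
    linear_combination h2 - ((m + m).factorial : K) * x * hσ
  have f1 : ((m - (m - 1)).factorial : K) = 1 := by
    rw [show m - (m - 1) = 1 by omega]; simp
  simp only [LevelRelation, f1, hm1, e4, e3, Nat.cast_ofNat] at h3 h4
  have r3 : 2 * (m + 2) * x - 2 * σ * y + (m + 2) * (m - 3) * z = 0 := by
    apply mul_left_cancel₀ (mul_ne_zero T10 (mul_ne_zero m1 (pow_ne_zero 2 (fz m (by omega)))))
    rw [e5] at h3 hσ
    rw [e1, e2] at *
    linear_combination h3 + 2 * ((m + (m - 1)).factorial : K) * y * hσ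
  have r4 : 2 * σ * x - 2 * (m + 2) * y - (m + 2) * (m - 3) * z = 0 := by
    apply mul_left_cancel₀ (mul_ne_zero T10 (mul_ne_zero m1 (pow_ne_zero 2 (fz m (by omega)))))
    rw [e5] at h4 hσ
    rw [e1, e2] at *
    linear_combination h4 - 2 * ((m + (m - 1)).factorial : K) * x * hσ
  have hxy : x = y := by
    have s1 : (m + 1) * 2 * (x - y) = 0 := by linear_combination r3 + r4 - 2 * r1 - 2 * r2
    exact sub_eq_zero.1 ((mul_eq_zero.1 s1).resolve_left (mul_ne_zero m1 t2))
  subst hxy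
  have r5 : x * (m + 2 + σ * (m - 4)) = 0 := by
    apply mul_left_cancel₀ m1
    linear_combination (m - 1) * r3 - (m + 2) * (m - 3) * r1
  suffices hx : x = 0 by simp [hx]
  obtain rfl | rfl | hm6 : m = 4 ∨ m = 5 ∨ 6 ≤ m := by omega
  · have : 2 * 3 * x = 0 := by push_cast at r5; linear_combination r5
    simpa [t2, t3] using this
  · have hσ' : σ = 42 := by
      have : σ * ((5 + 1) * (Nat.factorial 5 : K) ^ 2)
          = 42 * ((5 + 1) * (Nat.factorial 5) ^ 2) := by
        push_cast at hσ
        rw [← hσ]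
        norm_num [Nat.factorial]
      refine mul_right_cancel₀ (mul_ne_zero ?_ (pow_ne_zero 2 (fz 5 (by omega)))) this
      exact_mod_cast nz 6 (by omega) (by omega)
    have : 7 * 7 * x = 0 := by rw [hσ'] at r5; push_cast at r5; linear_combination r5
    simpa [t7] using this
  · have h5 := h 3 (m - 2) (by omega) (by omega) (by omega)
    have hm2 : ((m - 2 : ℕ) : K) = m - 2 := by push_cast [show 2 ≤ m by omega]; ring
    have e6 : ((m + 3).factorial : K) = (m + 3) * (m + 2).factorial :=
      natCast_factorial_eq (by omega) (by push_cast; ring)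
    have e7 : ((m - 2).factorial : K) = (m - 2) * (m - 3).factorial :=
      natCast_factorial_eq (by omega) (by push_cast [show 2 ≤ m by omega]; ring)
    have e8 : ((m + (m - 1)).factorial : K) = (2 * m - 1) * (m + (m - 2)).factorial :=
      natCast_factorial_eq (by omega) (by push_cast [show 1 ≤ m by omega]; ring)
    have f2 : ((m - (m - 2)).factorial : K) = 2 := by
      rw [show m - (m - 2) = 2 by omega]; simp
    simp only [LevelRelation, f2, hm2, e6, e4, e3, Nat.cast_ofNat] at h5
    have a30 : ((m - 3).factorial : K) ≠ 0 := fz _ (by omega)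
    have T20 : ((m + (m - 2)).factorial : K) ≠ 0 := fz _ (by omega)
    have r6 : 2 * (m + 2) * (m + 3) * (2 * m - 1) * x - 6 * σ * (m - 1) * x
        + (m - 5) * (m - 1) * (m + 2) * (m + 3) * z = 0 := by
      apply mul_left_cancel₀
        (mul_ne_zero T20 (mul_ne_zero m1 (pow_ne_zero 2 (fz m (by omega)))))
      rw [e5, e8] at h5 hσ
      simp only [e1, e2, e7] at h5 hσ ⊢
      linear_combination (m - 1) * h5 + 6 * (m - 1) * ((m + (m - 2)).factorial : K) * x * hσ
    have mm3 : (m : K) - 3 ≠ 0 := by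
      have := nz (m - 3) (by omega) (by omega)
      rw [Nat.cast_sub (by omega)] at this
      exact_mod_cast this
    have r7 : x * ((m + 2) * (m + 3) * 3 * (m + 1)
        + σ * ((m - 5) * (m + 2) * (m + 3) - 6 * (m - 1))) = 0 := by
      linear_combination r6 - (m - 5) * (m + 2) * (m + 3) * r1
    have : 2 * (m - 3) * (m + 1) * (m + 2) * (m + 2) * x = 0 := by
      linear_combination (m - 4) * r7 - ((m - 5) * (m + 2) * (m + 3) - 6 * (m - 1)) * r5
    simpa [t2, mm3, m1, m2] using this

end LevelRelations

omit [DecidableEq K] in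
lemma IsMomentSystem.levelRelation {m : ℕ} {α β γ α' β' γ' : ℕ → K}
    (h : IsMomentSystem m α β γ) (h' : IsMomentSystem m α' β' γ') {N : ℕ} (hN : 0 < N)
    (hN' : N < 2 * m) (hα : ∀ n < m + N, α n = α' n) (hβ : ∀ n < m + N, β n = β' n)
    (hγ : ∀ t < 2 * m, 2 * m < t + 1 + N → γ t = γ' t) {i j : ℕ} (hi : i ≤ m) (hj : j ≤ m)
    (hij : i + j = N) :
    LevelRelation m (2 * (2 * m - 1).factorial * (α (m + N) - α' (m + N)))
      (2 * (2 * m - 1).factorial * (β (m + N) - β' (m + N)))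
      ((2 * m - 1 - N).factorial * (γ (2 * m - 1 - N) - γ' (2 * m - 1 - N))) i j := by
  subst hij
  have hlin := h.linear_relation h' hi hj hN hN' hα hβ hγ
  have c1 := congrArg (Int.cast : ℤ → K) (antiChoose_mul_factorial
    (n := 2 * m - 1 - (i + j)) (a := m - i) (b := m - j) (by omega))
  have c2 := congrArg (Int.cast : ℤ → K) (antiChoose_mul_factorial
    (n := 2 * m - 1) (a := m + j) (b := m - j) (by omega))
  have c3 := congrArg (Int.cast : ℤ → K) (antiChoose_mul_factorial
    (n := 2 * m - 1) (a := m - i) (b := m + i) (by omega))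
  push_cast [hi, hj] at c1 c2 c3
  unfold LevelRelation
  linear_combination ((m - i).factorial : K) * (m - j).factorial * (m + i).factorial
      * (m + j).factorial * hlin
    - ((m + i).factorial : K) * (m + j).factorial
      * (γ (2 * m - 1 - (i + j)) - γ' (2 * m - 1 - (i + j))) * c1
    - ((m - i).factorial : K) * (m + i).factorial
      * (α (m + (i + j)) - α' (m + (i + j))) * c2
    - ((m - j).factorial : K) * (m + j).factorial
      * (β (m + (i + j)) - β' (m + (i + j))) * c3

omit [DecidableEq K] in
/-- A system of moments is determined by the first two nontrivial moments of the left set. -/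
lemma IsMomentSystem.eq_of_eq {m : ℕ} (hm : 4 ≤ m) (hF : ((2 * m).factorial : K) ≠ 0)
    {α β γ α' γ' : ℕ → K} (h : IsMomentSystem m α β γ) (h' : IsMomentSystem m α' α' γ')
    (h1 : α (m + 1) = α' (m + 1)) (h2 : α (m + 2) = α' (m + 2)) :
    ∀ n ≤ 2 * m + 1, α n = α' n ∧ β n = α' n := by
  have fz : ∀ k : ℕ, k ≤ 2 * m → (k.factorial : K) ≠ 0 := fun k =>
    natCast_factorial_ne_zero_of_le hF
  have t2 : (2 : K) ≠ 0 := by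
    exact_mod_cast natCast_ne_zero_of_factorial hF (k := 2) (by omega) (by omega)
  have key : ∀ N ≤ m + 1, α (m + N) = α' (m + N) ∧ β (m + N) = α' (m + N) ∧
      (N ≤ m → γ (2 * m - 1 - N) = γ' (2 * m - 1 - N)) := by
    intro N
    induction N using Nat.strong_induction_on with
    | _ N ih =>
      intro hN
      rcases Nat.eq_zero_or_pos N with rfl | hN0
      · simp [h.left_eq_one, h.right_eq_one, h.coeff_eq_one, h'.left_eq_one, h'.coeff_eq_one]
      have hα : ∀ n < m + N, α n = α' n := fun n hn => by
        rcases lt_or_ge n m with hnm | hnm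
        · rw [h.left_eq_zero n hnm, h'.left_eq_zero n hnm]
        · obtain ⟨r, rfl⟩ := Nat.exists_eq_add_of_le hnm
          exact (ih r (by omega) (by omega)).1
      have hβ : ∀ n < m + N, β n = α' n := fun n hn => by
        rcases lt_or_ge n m with hnm | hnm
        · rw [h.right_eq_zero n hnm, h'.left_eq_zero n hnm]
        · obtain ⟨r, rfl⟩ := Nat.exists_eq_add_of_le hnm
          exact (ih r (by omega) (by omega)).2.1
      have hγ : ∀ t < 2 * m, 2 * m < t + 1 + N → γ t = γ' t := fun t ht htN => by
        rw [show t = 2 * m - 1 - (2 * m - 1 - t) by omega]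
        exact (ih (2 * m - 1 - t) (by omega) (by omega)).2.2 (by omega)
      have rel := fun i j => h.levelRelation h' (i := i) (j := j) hN0 (by omega) hα hβ hγ
      have c0 : (2 : K) * (2 * m - 1).factorial ≠ 0 := mul_ne_zero t2 (fz _ (by omega))
      have c1 : ((2 * m - 1 - N).factorial : K) ≠ 0 := fz _ (by omega)
      have fin1 : ∀ {c x y : K}, c ≠ 0 → c * (x - y) = 0 → x = y := fun hc hxy =>
        sub_eq_zero.1 ((mul_eq_zero.1 hxy).resolve_left hc)
      rcases lt_or_ge N 3 with hN3 | hN3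
      · have hα0 : α (m + N) = α' (m + N) := by
          obtain rfl | rfl : N = 1 ∨ N = 2 := by omega
          · exact h1
          · exact h2
        have hu := levelRelation_zero_left hF hN0 (by omega)
          (rel 0 N (by omega) (by omega) (by omega))
        have hv := levelRelation_zero_right hF hN0 (by omega)
          (rel N 0 (by omega) (by omega) (by omega))
        rw [hα0, sub_self, mul_zero, mul_zero, add_zero] at hu
        rw [hu, zero_add] at hv
        exact ⟨hα0, fin1 c0 ((mul_eq_zero.1 hv).resolve_left (fz _ (by omega))),
          fun _ => fin1 c1 ((mul_eq_zero.1 hu).resolve_left (fz _ (by omega)))⟩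
      · rcases lt_or_ge m N with hNm | hNm
        · obtain rfl : N = m + 1 := by omega
          obtain ⟨hu, hv⟩ := eq_zero_of_levelRelation_succ hm hF rel
          exact ⟨fin1 c0 hu, fin1 c0 hv, fun hh => by omega⟩
        · obtain ⟨hu, hv, hw⟩ := eq_zero_of_levelRelation_of_le hm hF hN3 hNm rel
          exact ⟨fin1 c0 hu, fin1 c0 hv, fun _ => fin1 c1 hw⟩
  intro n hn
  rcases lt_or_ge n m with hnm | hnm
  · rw [h.left_eq_zero n hnm, h.right_eq_zero n hnm, h'.left_eq_zero n hnm]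
    exact ⟨rfl, rfl⟩
  · obtain ⟨r, rfl⟩ := Nat.exists_eq_add_of_le hnm
    obtain ⟨ha, hb, -⟩ := key r (by omega)
    exact ⟨ha, hb⟩

omit [DecidableEq K] in
lemma Polynomial.Monic.eq_of_sum_coeff_mul_eq_zero {m : ℕ} {g g' : K[X]} (hg : g.Monic)
    (hg' : g'.Monic) (hdeg : g.natDegree = m + 1) (hdeg' : g'.natDegree = m + 1) {α : ℕ → K}
    (hα0 : ∀ n < m, α n = 0) (hα1 : α m = 1)
    (h : ∀ n ≤ m, ∑ j ∈ range (m + 2), g.coeff j * α (n + j) = 0)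
    (h' : ∀ n ≤ m, ∑ j ∈ range (m + 2), g'.coeff j * α (n + j) = 0) : g = g' := by
  have top : g.coeff (m + 1) = g'.coeff (m + 1) := by
    rw [← hdeg, hg.coeff_natDegree, hdeg, ← hdeg', hg'.coeff_natDegree]
  have key : ∀ n ≤ m, g.coeff (m - n) = g'.coeff (m - n) := by
    intro n
    induction n using Nat.strong_induction_on with
    | _ n ih =>
      intro hn
      have hsum : ∑ j ∈ range (m + 2), (g.coeff j - g'.coeff j) * α (n + j) = 0 := by
        simp only [sub_mul, sum_sub_distrib, h n hn, h' n hn, sub_zero]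
      rw [sum_eq_single (m - n)] at hsum
      · rw [show n + (m - n) = m by omega, hα1, mul_one] at hsum
        exact sub_eq_zero.1 hsum
      · intro j hj hjn
        have hj := mem_range.1 hj
        rcases lt_or_gt_of_ne hjn with hlt | hlt
        · rw [hα0 _ (by omega), mul_zero]
        · suffices g.coeff j = g'.coeff j by rw [this, sub_self, zero_mul]
          rcases Nat.lt_or_ge m j with hmj | hmj
          · rwa [show j = m + 1 by omega]
          · rw [show j = m - (m - j) by omega]
            exact ih (m - j) (by omega) (by omega)
      · intro hh; exact absurd (mem_range.2 (by omega)) hh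
  ext j
  rcases lt_trichotomy j (m + 1) with hj | rfl | hj
  · rw [show j = m - (m - j) by omega]
    exact key _ (by omega)
  · exact top
  · rw [coeff_eq_zero_of_natDegree_lt (by omega), coeff_eq_zero_of_natDegree_lt (by omega)]

lemma two_mul_coeff_prod_X_sub_C (A : Finset K) : ∀ n, #A = n + 2 →
    2 * (∏ a ∈ A, (X - C a)).coeff n = (∑ a ∈ A, a) ^ 2 - ∑ a ∈ A, a ^ 2 := by
  induction A using Finset.induction_on with
  | empty => intro n hn; simp at hn
  | insert a s ha ih =>
    intro n hn
    rw [card_insert_of_notMem ha] at hn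
    have hpred := prod_X_sub_C_coeff_card_pred s (fun i => i) (by omega)
    rw [show #s - 1 = n by omega] at hpred
    rw [prod_insert ha, sum_insert ha, sum_insert ha]
    obtain _ | n := n
    · obtain ⟨b, rfl⟩ := card_eq_one.1 (show #s = 1 by omega)
      simp [mul_coeff_zero]
      ring
    · have := ih n (by omega)
      rw [coeff_X_sub_C_mul, hpred]
      linear_combination this

lemma nodalMoment_card {A : Finset K} {m : ℕ} (hA : #A = m + 1) :
    nodalMoment A (m + 1) = ∑ a ∈ A, a := by
  have h := sum_coeff_mul_nodalMoment (A := A) (g := ∏ a ∈ A, (X - C a))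
    (fun a ha => by rw [eval_prod]; exact prod_eq_zero ha (by simp)) (L := m + 2)
    (by rw [natDegree_finsetProd_X_sub_C_eq_card]; omega) 0
  have hpred := prod_X_sub_C_coeff_card_pred A (fun i => i) (by omega)
  have hmon : (∏ a ∈ A, (X - C a)).Monic := monic_prod_X_sub_C (fun i => i) A
  have hdeg : (∏ a ∈ A, (X - C a)).natDegree = #A := natDegree_finsetProd_X_sub_C_eq_card A _
  have hlead := hmon.coeff_natDegree
  rw [hdeg, hA] at hlead
  rw [hA, Nat.add_sub_cancel] at hpred
  rw [sum_range_succ, sum_range_succ, sum_eq_zero] at h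
  · simp only [zero_add] at h
    rw [hlead, nodalMoment_eq_one (n := m) (by omega), hpred] at h
    linear_combination h
  · intro j hj
    have := mem_range.1 hj
    rw [nodalMoment_eq_zero (by omega), mul_zero]

lemma two_mul_nodalMoment_card_succ {A : Finset K} {m : ℕ} (hm : 0 < m) (hA : #A = m + 1) :
    2 * nodalMoment A (m + 2) = (∑ a ∈ A, a) ^ 2 + ∑ a ∈ A, a ^ 2 := by
  have h := sum_coeff_mul_nodalMoment (A := A) (g := ∏ a ∈ A, (X - C a))
    (fun a ha => by rw [eval_prod]; exact prod_eq_zero ha (by simp)) (L := m + 2)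
    (by rw [natDegree_finsetProd_X_sub_C_eq_card]; omega) 1
  have hpred := prod_X_sub_C_coeff_card_pred A (fun i => i) (by omega)
  have hmon : (∏ a ∈ A, (X - C a)).Monic := monic_prod_X_sub_C (fun i => i) A
  have hdeg : (∏ a ∈ A, (X - C a)).natDegree = #A := natDegree_finsetProd_X_sub_C_eq_card A _
  have hlead := hmon.coeff_natDegree
  obtain ⟨r, rfl⟩ : ∃ r, m = r + 1 := ⟨m - 1, by omega⟩
  have h2 := two_mul_coeff_prod_X_sub_C A r (by omega)
  rw [hdeg, hA] at hlead
  rw [hA, Nat.add_sub_cancel] at hpred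
  rw [sum_range_succ, sum_range_succ, sum_range_succ, sum_eq_zero] at h
  · rw [hlead, hpred, show 1 + r = r + 1 by omega, nodalMoment_eq_one (n := r + 1) (by omega),
      show 1 + (r + 1) = r + 1 + 1 by omega, nodalMoment_card hA,
      show 1 + (r + 1 + 1) = r + 1 + 2 by omega] at h
    linear_combination 2 * h - h2
  · intro j hj
    have := mem_range.1 hj
    rw [nodalMoment_eq_zero (by omega), mul_zero]

omit [DecidableEq K] in
lemma two_mul_sum_range_sub (n : ℕ) (t : K) :
    2 * ∑ j ∈ range n, ((j : K) - t) = n * (n - 1) - 2 * t * n := by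
  induction n with
  | zero => simp
  | succ n ih => rw [sum_range_succ, mul_add, ih]; push_cast; ring

omit [DecidableEq K] in
lemma six_mul_sum_range_sub_sq (n : ℕ) (t : K) :
    6 * ∑ j ∈ range n, ((j : K) - t) ^ 2
      = n * (n - 1) * (2 * n - 1) - 6 * t * (n * (n - 1)) + 6 * t ^ 2 * n := by
  induction n with
  | zero => simp
  | succ n ih => rw [sum_range_succ, mul_add, ih]; push_cast; ring

/-- The arithmetic progression of length `m + 1` and difference `1` centred at zero. -/
def centeredProgression (K : Type*) [Field K] [DecidableEq K] (m : ℕ) : Finset K :=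
  (range (m + 1)).image fun j : ℕ => (j : K) - m / 2

section CenteredProgression

variable {m : ℕ}

omit [DecidableEq K] in
lemma injOn_natCast_sub_div_two (hF : (m.factorial : K) ≠ 0) :
    Set.InjOn (fun j : ℕ => (j : K) - m / 2) (range (m + 1)) := by
  have aux : ∀ i j : ℕ, i < j → j ≤ m → (i : K) ≠ j := by
    intro i j hij hj h
    have := natCast_ne_zero_of_factorial hF (k := j - i) (by omega) (by omega)
    rw [Nat.cast_sub hij.le, h, sub_self] at this
    exact this rfl
  intro i hi j hj h
  have hi := mem_range.1 (mem_coe.1 hi)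
  have hj := mem_range.1 (mem_coe.1 hj)
  have h' : (i : K) = j := sub_left_injective h
  rcases lt_trichotomy i j with hlt | heq | hlt
  · exact absurd h' (aux i j hlt (by omega))
  · exact heq
  · exact absurd h'.symm (aux j i hlt (by omega))

lemma card_centeredProgression (hF : (m.factorial : K) ≠ 0) :
    #(centeredProgression K m) = m + 1 := by
  rw [centeredProgression, card_image_of_injOn (injOn_natCast_sub_div_two hF), card_range]

lemma sum_centeredProgression (hF : (m.factorial : K) ≠ 0) (h2 : (2 : K) ≠ 0) :
    ∑ a ∈ centeredProgression K m, a = 0 := by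
  rw [centeredProgression, sum_image (injOn_natCast_sub_div_two hF)]
  apply mul_left_cancel₀ h2
  rw [two_mul_sum_range_sub]
  push_cast
  field_simp
  ring

lemma sum_sq_centeredProgression (hF : (m.factorial : K) ≠ 0) (h2 : (2 : K) ≠ 0) :
    12 * ∑ a ∈ centeredProgression K m, a ^ 2 = m * (m + 1) * (m + 2) := by
  rw [centeredProgression, sum_image (injOn_natCast_sub_div_two hF)]
  have h := six_mul_sum_range_sub_sq (m + 1) ((m : K) / 2)
  push_cast at h
  have h' : (12 : K) * ∑ j ∈ range (m + 1), ((j : K) - m / 2) ^ 2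
      = 2 * (6 * ∑ j ∈ range (m + 1), ((j : K) - m / 2) ^ 2) := by ring
  rw [h', h]
  field_simp
  ring

lemma isMomentSystem_centeredProgression (hm : 0 < m) (hF : (m.factorial : K) ≠ 0)
    (h2 : (2 : K) ≠ 0) : ∃ γ, IsMomentSystem m (nodalMoment (centeredProgression K m))
      (nodalMoment (centeredProgression K m)) γ := by
  refine ⟨_, isMomentSystem_of_eval_eq_zero (c := ∏ n ∈ range (2 * m - 1),
    (X - C ((n : K) + 1 - m))) hm ?_ (monic_prod_X_sub_C _ _)
    (card_centeredProgression hF) (card_centeredProgression hF)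
    (by rw [natDegree_finsetProd_X_sub_C_eq_card, card_range])⟩
  intro a ha b hb
  obtain ⟨i, hi, rfl⟩ := mem_image.1 ha
  obtain ⟨j, hj, rfl⟩ := mem_image.1 hb
  have hi := mem_range.1 hi
  have hj := mem_range.1 hj
  by_cases hij : i = j
  · subst hij; simp
  · apply mul_eq_zero_of_right
    rw [eval_prod]
    refine prod_eq_zero (mem_range.2 (show i + j - 1 < 2 * m - 1 by omega)) ?_
    rw [Nat.cast_sub (by omega)]
    have : (m : K) / 2 + m / 2 = m := by field_simp; ring
    simp only [eval_sub, eval_X, eval_C]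
    push_cast
    linear_combination -this

end CenteredProgression

/-- If `(x - y) * c (x + y)` vanishes on `A × B`, where `|A| = |B| = m + 1`, the sum of `A` is zero
and `c` is monic of degree `2 * m - 1`, then `A` and `B` equal the same dilate of a centred
progression. -/
lemma exists_eq_image_centeredProgression [IsAlgClosed K] {m : ℕ} (hm : 4 ≤ m)
    (hF : ((2 * m).factorial : K) ≠ 0) {A B : Finset K} {c : K[X]}
    (hc : ∀ a ∈ A, ∀ b ∈ B, (a - b) * c.eval (a + b) = 0) (hmon : c.Monic)
    (hA : #A = m + 1) (hB : #B = m + 1) (hdeg : c.natDegree = 2 * m - 1)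
    (hsum : ∑ a ∈ A, a = 0) :
    ∃ d : K, A = (centeredProgression K m).image (d * ·) ∧
      B = (centeredProgression K m).image (d * ·) := by
  have nz : ∀ k : ℕ, 0 < k → k ≤ 2 * m → (k : K) ≠ 0 := fun k =>
    natCast_ne_zero_of_factorial hF
  have hF' : (m.factorial : K) ≠ 0 := natCast_factorial_ne_zero_of_le hF (by omega)
  have t2 : (2 : K) ≠ 0 := by exact_mod_cast nz 2 (by omega) (by omega)
  set S := centeredProgression K m with hS
  have hScard : #S = m + 1 := card_centeredProgression hF'
  have hSsum : ∑ a ∈ S, a = 0 := sum_centeredProgression hF' t2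
  have hS2 : nodalMoment S (m + 2) ≠ 0 := by
    intro h0
    have h1 := two_mul_nodalMoment_card_succ (by omega) hScard
    have h2 : 12 * ∑ a ∈ S, a ^ 2 = (m : K) * (m + 1) * (m + 2) :=
      sum_sq_centeredProgression hF' t2
    rw [h0, hSsum] at h1
    have h3 : (m : K) * (m + 1) * (m + 2) = 0 := by linear_combination -h2 - 12 * h1
    have m0 : (m : K) ≠ 0 := nz m (by omega) (by omega)
    have m1 : (m : K) + 1 ≠ 0 := by exact_mod_cast nz (m + 1) (by omega) (by omega)
    have m2 : (m : K) + 2 ≠ 0 := by exact_mod_cast nz (m + 2) (by omega) (by omega)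
    exact mul_ne_zero (mul_ne_zero m0 m1) m2 h3
  obtain ⟨d, hd⟩ := IsAlgClosed.exists_pow_nat_eq (nodalMoment A (m + 2) / nodalMoment S (m + 2))
    zero_lt_two
  obtain ⟨γ, hγ⟩ := isMomentSystem_centeredProgression (K := K) (m := m) (by omega) hF' t2
  have hmom := (isMomentSystem_of_eval_eq_zero (by omega) hc hmon hA hB hdeg).eq_of_eq hm hF
    (hγ.scale d)
    (by rw [nodalMoment_card hA, ← hS, nodalMoment_card hScard, hsum, hSsum, mul_zero])
    (by simp only [Nat.add_sub_cancel_left]; rw [hd, ← hS, div_mul_cancel₀ _ hS2])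
  have hsys := hγ.scale d
  rw [← hS] at hsys
  refine ⟨d, ?_⟩
  set gS : K[X] := ∏ a ∈ S, (X - C a) with hgS
  have hgSdeg : gS.natDegree = m + 1 := by
    rw [hgS, natDegree_finsetProd_X_sub_C_eq_card, hScard]
  have hgSroot : ∀ a ∈ S, gS.eval a = 0 := fun a ha => by
    rw [hgS, eval_prod]; exact prod_eq_zero ha (by simp)
  have hmodel : ∀ n ≤ m, ∑ j ∈ range (m + 2),
      (gS.scaleRoots d).coeff j * (d ^ (n + j - m) * nodalMoment S (n + j)) = 0 := by
    intro n hn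
    calc _ = d ^ (n + 1) * ∑ j ∈ range (m + 2), gS.coeff j * nodalMoment S (n + j) := by
          rw [mul_sum]
          refine sum_congr rfl fun j hj => ?_
          have hj := mem_range.1 hj
          rcases lt_or_ge (n + j) m with hlt | hge
          · rw [nodalMoment_eq_zero (by omega)]; ring
          · rw [coeff_scaleRoots, hgSdeg, show n + 1 = (m + 1 - j) + (n + j - m) by omega, pow_add]
            ring
      _ = 0 := by rw [sum_coeff_mul_nodalMoment hgSroot (by omega), mul_zero]
  have main : ∀ E : Finset K, #E = m + 1 →
      (∀ n ≤ 2 * m + 1, nodalMoment E n = d ^ (n - m) * nodalMoment S n) →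
      E = S.image (d * ·) := by
    intro E hE hEmom
    have hEdeg : (∏ a ∈ E, (X - C a)).natDegree = m + 1 := by
      rw [natDegree_finsetProd_X_sub_C_eq_card, hE]
    have hEroot : ∀ a ∈ E, (∏ a ∈ E, (X - C a)).eval a = 0 := fun a ha => by
      rw [eval_prod]; exact prod_eq_zero ha (by simp)
    have hpoly : ∏ a ∈ E, (X - C a) = gS.scaleRoots d := by
      refine (monic_prod_X_sub_C (fun i => i) E).eq_of_sum_coeff_mul_eq_zero
        ((monic_scaleRoots_iff d).2 (monic_prod_X_sub_C (fun i => i) S)) hEdeg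
        (by rw [natDegree_scaleRoots, hgSdeg]) hsys.left_eq_zero hsys.left_eq_one ?_ hmodel
      intro n hn
      rw [← sum_coeff_mul_nodalMoment hEroot (L := m + 2) (by omega) n]
      refine sum_congr rfl fun j hj => ?_
      have hj := mem_range.1 hj
      rw [hEmom _ (by omega)]
    have hd0 : d ≠ 0 := by
      rintro rfl
      have hsub : E ⊆ {0} := fun a ha => by
        have := hEroot a ha
        rw [hpoly, scaleRoots_zero, hgSdeg] at this
        simpa [(monic_prod_X_sub_C (fun i => i) S).leadingCoeff, hgS] using this
      have := card_le_card hsub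
      rw [card_singleton] at this
      omega
    symm
    refine eq_of_subset_of_card_le ?_ ?_
    · intro x hx
      obtain ⟨s, hs, rfl⟩ := mem_image.1 hx
      have h0 : (∏ a ∈ E, (X - C a)).eval (d * s) = 0 := by
        rw [hpoly, scaleRoots_eval_mul, hgSroot s hs, mul_zero]
      rw [eval_prod, prod_eq_zero_iff] at h0
      obtain ⟨a, ha, h0⟩ := h0
      rw [eval_sub, eval_X, eval_C, sub_eq_zero] at h0
      rwa [h0]
    · rw [card_image_of_injective _ (mul_right_injective₀ hd0), hE, hScard]
  exact ⟨main A hA fun n hn => (hmom n hn).1, main B hB fun n hn => (hmom n hn).2⟩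

section ZMod

variable {p : ℕ} [Fact p.Prime]

omit [DecidableEq K] in
lemma natCast_factorial_ne_zero_of_lt [CharP K p] {n : ℕ} (hn : n < p) :
    (n.factorial : K) ≠ 0 := by
  rw [Ne, CharP.cast_eq_zero_iff K p, (Fact.out : p.Prime).dvd_factorial]
  omega

lemma injOn_add_natCast_mul {x d : ZMod p} (hd : d ≠ 0) :
    Set.InjOn (fun j : ℕ => x + (j : ZMod p) * d) (Set.Iio p) := by
  intro i hi j hj h
  exact CharP.natCast_injOn_Iio (ZMod p) p hi hj (mul_right_cancel₀ hd (add_left_cancel h))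

lemma card_image_add_distinct_of_progression {x d : ZMod p} (hd : d ≠ 0) {k : ℕ} (hk : 2 ≤ k)
    (hkp : 2 * k - 3 < p) {A : Finset (ZMod p)}
    (hA : A = (range k).image fun j : ℕ => x + (j : ZMod p) * d) :
    #(((A ×ˢ A).filter fun q => q.1 ≠ q.2).image fun q => q.1 + q.2) = 2 * k - 3 := by
  have key : (((A ×ˢ A).filter fun q => q.1 ≠ q.2).image fun q => q.1 + q.2)
      = (Icc 1 (2 * k - 3)).image fun n : ℕ => 2 * x + (n : ZMod p) * d := by
    ext s
    simp only [mem_image, mem_filter, mem_product, Prod.exists, mem_Icc]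
    constructor
    · rintro ⟨a, b, ⟨⟨ha, hb⟩, hne⟩, rfl⟩
      rw [hA] at ha hb
      obtain ⟨i, hi, rfl⟩ := mem_image.1 ha
      obtain ⟨j, hj, rfl⟩ := mem_image.1 hb
      have hi := mem_range.1 hi
      have hj := mem_range.1 hj
      have hij : i ≠ j := by rintro rfl; exact hne rfl
      exact ⟨i + j, ⟨by omega, by omega⟩, by push_cast; ring⟩
    · rintro ⟨n, ⟨hn1, hn2⟩, rfl⟩
      obtain ⟨i, j, hij, hj, rfl⟩ : ∃ i j : ℕ, i < j ∧ j < k ∧ n = i + j := by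
        rcases lt_or_ge n k with h | h
        · exact ⟨0, n, by omega, h, by omega⟩
        · exact ⟨n - (k - 1), k - 1, by omega, by omega, by omega⟩
      have mem : ∀ l < k, x + (l : ZMod p) * d ∈ A := fun l hl => by
        rw [hA]; exact mem_image_of_mem _ (mem_range.2 hl)
      refine ⟨_, _, ⟨⟨mem i (by omega), mem j hj⟩, fun h => ?_⟩, by push_cast; ring⟩
      have hk' : (i : ZMod p) = j := mul_right_cancel₀ hd (add_left_cancel h)
      have hd' : ((j - i : ℕ) : ZMod p) = 0 := by rw [Nat.cast_sub hij.le, hk', sub_self]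
      rw [CharP.cast_eq_zero_iff (ZMod p) p] at hd'
      have := Nat.le_of_dvd (by omega) hd'
      omega
  rw [key, card_image_of_injOn, Nat.card_Icc, Nat.add_sub_cancel]
  refine (injOn_add_natCast_mul hd).mono fun n hn => ?_
  have := mem_Icc.1 (mem_coe.1 hn)
  exact Set.mem_Iio.2 (by omega)

lemma card_image_range_lt {x d : ZMod p} (hd : d ≠ 0) {l : ℕ}
    (h : #((range l).image fun j : ℕ => x + (j : ZMod p) * d) < p) :
    #((range l).image fun j : ℕ => x + (j : ZMod p) * d) = l := by
  have hinj : ∀ l ≤ p, #((range l).image fun j : ℕ => x + (j : ZMod p) * d) = l := fun l hl => by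
    rw [card_image_of_injOn, card_range]
    exact (injOn_add_natCast_mul hd).mono fun n hn =>
      (mem_range.1 (mem_coe.1 hn)).trans_le hl
  refine hinj l (le_of_not_gt fun hl => ?_)
  have := card_le_card (image_subset_image (f := fun j : ℕ => x + (j : ZMod p) * d)
    (range_subset_range.2 hl.le))
  rw [hinj p le_rfl] at this
  omega

lemma eq_and_exists_progression_of_card {A B : Finset (ZMod p)} {m n : ℕ} (hm : 4 ≤ m)
    (hmn : m + n < p) (hA : #A = m + 1) (hB : #B = n + 2)
    (hC : #(((A ×ˢ B).filter fun q => q.1 ≠ q.2).image fun q => q.1 + q.2) = m + n) :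
    A = B ∧ ∃ x d : ZMod p, d ≠ 0 ∧
      A = (range (m + 1)).image fun j : ℕ => x + (j : ZMod p) * d := by
  classical
  let K := AlgebraicClosure (ZMod p)
  have : CharP K p := charP_of_injective_algebraMap (algebraMap (ZMod p) K).injective p
  set φ : ZMod p →+* K := algebraMap (ZMod p) K with hφ
  set S := ((A ×ˢ B).filter fun q => q.1 ≠ q.2).image fun q => q.1 + q.2 with hS
  set t : K := (∑ a ∈ A, φ a) / ((m + 1 : ℕ) : K) with ht
  have hinj : Function.Injective fun a => φ a - t := sub_left_injective.comp φ.injective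
  set c : K[X] := ∏ s ∈ S, (X - C (φ s - 2 * t)) with hc
  have hcmon : c.Monic := monic_prod_X_sub_C _ _
  have hcdeg : c.natDegree = m + n := by rw [hc, natDegree_finsetProd_X_sub_C_eq_card, hC]
  have hvan : ∀ a ∈ A.image fun a => φ a - t, ∀ b ∈ B.image fun a => φ a - t,
      (a - b) * c.eval (a + b) = 0 := by
    intro a' ha' b' hb'
    obtain ⟨a, ha, rfl⟩ := mem_image.1 ha'
    obtain ⟨b, hb, rfl⟩ := mem_image.1 hb'
    by_cases hab : a = b
    · subst hab; simp
    · apply mul_eq_zero_of_right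
      rw [hc, eval_prod]
      refine prod_eq_zero (i := a + b)
        (mem_image.2 ⟨(a, b), mem_filter.2 ⟨mem_product.2 ⟨ha, hb⟩, hab⟩, rfl⟩) ?_
      simp only [eval_sub, eval_X, eval_C, map_add]
      ring
  have hA' : #(A.image fun a => φ a - t) = m + 1 := by rw [card_image_of_injective _ hinj, hA]
  have hB' : #(B.image fun a => φ a - t) = n + 2 := by rw [card_image_of_injective _ hinj, hB]
  obtain rfl : m = n + 1 := by
    have h := factorial_mul_card_sub_card_eq_zero hvan hcmon hA' hB' hcdeg
    have h' : (m : K) = ((n + 1 : ℕ) : K) := by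
      push_cast
      exact sub_eq_zero.1 ((mul_eq_zero.1 h).resolve_left (natCast_factorial_ne_zero_of_lt hmn))
    exact CharP.natCast_injOn_Iio K p (Set.mem_Iio.2 (by omega)) (Set.mem_Iio.2 (by omega)) h'
  have hp2 : 2 * (n + 1) < p := by
    rcases (Fact.out : p.Prime).eq_two_or_odd with h | h <;> omega
  have ne0 : ((n + 1 + 1 : ℕ) : K) ≠ 0 := by
    rw [Ne, CharP.cast_eq_zero_iff K p]
    exact Nat.not_dvd_of_pos_of_lt (by omega) (by omega)
  have hsum : ∑ a ∈ A.image fun a => φ a - t, a = 0 := by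
    rw [sum_image hinj.injOn, sum_sub_distrib, sum_const, hA, nsmul_eq_mul, ht,
      mul_div_cancel₀ _ ne0, sub_self]
  obtain ⟨d, hAd, hBd⟩ := exists_eq_image_centeredProgression hm
    (natCast_factorial_ne_zero_of_lt hp2) hvan hcmon hA' hB' (by omega) hsum
  have hmem : ∀ j ≤ n + 1, ∃ a ∈ A, φ a - t = d * ((j : K) - ((n + 1 : ℕ) : K) / 2) := by
    intro j hj
    have : d * ((j : K) - ((n + 1 : ℕ) : K) / 2) ∈ A.image fun a => φ a - t := by
      rw [hAd]
      exact mem_image_of_mem _ (mem_image_of_mem _ (mem_range.2 (by omega)))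
    exact mem_image.1 this
  obtain ⟨x, hxA, hx⟩ := hmem 0 (by omega)
  obtain ⟨y, hyA, hy⟩ := hmem 1 (by omega)
  have hd : φ (y - x) = d := by
    rw [map_sub]
    push_cast at hx hy
    linear_combination hy - hx
  refine ⟨image_injective hinj (hAd.trans hBd.symm), x, y - x, ?_, ?_⟩
  · intro h0
    rw [h0, map_zero] at hd
    have hsub : A.image (fun a => φ a - t) ⊆ {0} := by
      rw [hAd, ← hd]
      intro z hz
      obtain ⟨s, -, rfl⟩ := mem_image.1 hz
      simp
    have := card_le_card hsub
    rw [card_singleton] at this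
    omega
  · refine eq_of_subset_of_card_le (fun a ha => ?_)
      (card_image_le.trans (by simp [hA]))
    have : φ a - t ∈ A.image fun a => φ a - t := mem_image_of_mem _ ha
    rw [hAd] at this
    obtain ⟨s, hs, h⟩ := mem_image.1 this
    obtain ⟨j, hj, rfl⟩ := mem_image.1 hs
    refine mem_image.2 ⟨j, hj, φ.injective ?_⟩
    rw [map_add, map_mul, map_natCast, hd]
    push_cast at hx h
    linear_combination hx + h

end ZMod

end

/-- (Károlyi's inverse theorem) Let `p` be a prime and let `A` and `B` be subsets of
`F = ℤ/pℤ` with `p > |A| + |B| − 3`, `|A| ≥ 5` and `|B| ≥ 5`.  Then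
`|A ∔ B| = |A| + |B| − 3` if and only if `A = B` and `A` is an arithmetic progression
with nonzero common difference. -/
theorem karolyi_inverse (p : ℕ) (hp : p.Prime) (A B : Finset (ZMod p))
    (hpk : A.card + B.card - 3 < p) (hA : 5 ≤ A.card) (hB : 5 ≤ B.card) :
    ((((A ×ˢ B).filter fun q => q.1 ≠ q.2).image fun q => q.1 + q.2)).card
        = A.card + B.card - 3 ↔
      (A = B ∧ ∃ d : ZMod p, d ≠ 0 ∧ IsAPWithDiff A d) := by
  have : Fact p.Prime := ⟨hp⟩
  constructor
  · intro h
    obtain ⟨hAB, x, d, hd, hx⟩ := eq_and_exists_progression_of_card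
      (m := A.card - 1) (n := B.card - 2) (by omega) (by omega) (by omega) (by omega)
      (h.trans (by omega))
    exact ⟨hAB, d, hd, x, _, hx⟩
  · rintro ⟨rfl, d, hd, x, l, hx⟩
    have hl : A.card = l := by
      have h := card_image_range_lt (x := x) (l := l) hd
      rw [← hx] at h
      exact h (by omega)
    rw [card_image_add_distinct_of_progression hd (by omega) (by omega) hx]
    omega
end

section
/- (Károlyi) Let G be an abelian group and let A and B be nonempty finite subsets of G with |A| = k and |B| = ℓ. If p(G) ≥ k + ℓ − 1, then the sumset satisfies |A + B| ≥ k + ℓ − 1. -/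
open Pointwise

/-- `p(G)`: the smallest positive integer `p` for which there exists a nonzero element
`g` of `G` with `p • g = 0`; if no such `p` exists, `p(G) = ∞`. -/
noncomputable def pOf (G : Type*) [AddCommGroup G] : ℕ∞ :=
  sInf {n : ℕ∞ | ∃ m : ℕ, n = (m : ℕ∞) ∧ 0 < m ∧ ∃ g : G, g ≠ 0 ∧ m • g = 0}

/-- (Károlyi) Let `G` be an abelian group and let `A` and `B` be nonempty finite subsets
of `G` with `|A| = k` and `|B| = ℓ`.  If `p(G) ≥ k + ℓ − 1`, then the sumset satisfies
`|A + B| ≥ k + ℓ − 1`. -/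
theorem karolyi_cauchy_davenport (G : Type*) [AddCommGroup G] [DecidableEq G]
    (A B : Finset G) (k ℓ : ℕ) (hA : A.Nonempty) (hB : B.Nonempty)
    (hAk : A.card = k) (hBl : B.card = ℓ)
    (hp : ((k + ℓ - 1 : ℕ) : ℕ∞) ≤ pOf G) :
    k + ℓ - 1 ≤ (A + B).card := by
  subst hAk hBl
  have h_order : pOf G ≤ AddMonoid.minOrder G := AddMonoid.le_minOrder.2 fun g hg hfin =>
    sInf_le ⟨addOrderOf g, rfl, hfin.addOrderOf_pos, g, hg, addOrderOf_nsmul_eq_zero g⟩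
  have h_min := cauchy_davenport_minOrder_add hA hB
  rw [min_eq_right (hp.trans h_order)] at h_min
  exact_mod_cast h_min
end

section
/- Let k ≥ 2 be an integer and p a prime with p > 2k − 2. Then for every integer i with 0 ≤ i ≤ k − 1, the integer binom(2k−2, k+i−1) − binom(2k−2, k+i) is not divisible by p (where binom(2k−2, 2k−1) is interpreted as 0). In other words, the coefficient of x^{k+i} y^{k−1−i} in (x − y)(x + y)^{2k−2} is nonzero in ℤ/pℤ. -/
open MvPolynomial

/-- The binary form of the binomial theorem, read off coefficientwise. -/
theorem coeff_X_add_X_pow {R : Type*} [CommSemiring R] {a b n : ℕ} (h : a + b = n) :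
    coeff (Finsupp.single (0 : Fin 2) a + Finsupp.single 1 b)
      ((X 0 + X 1) ^ n : MvPolynomial (Fin 2) R) = (n.choose a : R) := by
  classical
  have key : ∀ m, coeff (Finsupp.single (0 : Fin 2) a + Finsupp.single 1 b)
      (X 0 ^ m * X 1 ^ (n - m) * (n.choose m : MvPolynomial (Fin 2) R)) =
        if a = m then (n.choose m : R) else 0 := by
    intro m
    rw [← map_natCast (C : R →+* MvPolynomial (Fin 2) R), mul_comm, coeff_C_mul,
      X_pow_eq_monomial, X_pow_eq_monomial, monomial_mul, coeff_monomial]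
    by_cases ham : a = m
    · subst ham
      have hb : n - a = b := by omega
      simp [hb]
    · have hne : Finsupp.single (0 : Fin 2) m + Finsupp.single 1 (n - m) ≠
          Finsupp.single (0 : Fin 2) a + Finsupp.single 1 b := by
        intro he
        have := DFunLike.congr_fun he 0
        simp at this
        exact ham this.symm
      rw [if_neg hne, mul_zero, if_neg ham]
  rw [add_pow, coeff_sum, Finset.sum_congr rfl fun m _ => key m]
  simp
  omega

theorem coeff_X_sub_X_mul_X_add_X_pow {R : Type*} [CommRing R] {a b n : ℕ} (h : a + b = n) :
    coeff (Finsupp.single (0 : Fin 2) (a + 1) + Finsupp.single 1 b)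
      ((X 0 - X 1) * (X 0 + X 1) ^ n : MvPolynomial (Fin 2) R) =
        (n.choose a : R) - (n.choose (a + 1) : R) := by
  classical
  have h0 : Finsupp.single (0 : Fin 2) (a + 1) + Finsupp.single 1 b =
      Finsupp.single 0 1 + (Finsupp.single (0 : Fin 2) a + Finsupp.single 1 b) := by
    rw [← add_assoc, ← Finsupp.single_add, add_comm 1 a]
  rw [sub_mul, coeff_sub]
  congr 1
  · rw [h0, coeff_X_mul, coeff_X_add_X_pow h]
  · rcases b with _ | b
    · rw [coeff_X_mul', if_neg (by simp), Nat.choose_eq_zero_of_lt (by omega), Nat.cast_zero]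
    · have h1 : Finsupp.single (0 : Fin 2) (a + 1) + Finsupp.single 1 (b + 1) =
          Finsupp.single 1 1 + (Finsupp.single (0 : Fin 2) (a + 1) + Finsupp.single 1 b) := by
        rw [add_left_comm, ← Finsupp.single_add, add_comm 1 b]
      rw [h1, coeff_X_mul, coeff_X_add_X_pow (by omega)]

theorem Nat.Prime.not_dvd_choose_of_lt {p n a : ℕ} (hp : p.Prime) (hn : n < p) (ha : a ≤ n) :
    ¬ p ∣ n.choose a := fun h =>
  absurd ((hp.dvd_factorial).1 (Nat.choose_mul_factorial_mul_factorial ha ▸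
    ((h.mul_right _).mul_right _))) (by omega)

theorem Nat.Prime.not_dvd_choose_sub_choose_succ {p n a : ℕ} (hp : p.Prime) (hn : n < p)
    (ha : a ≤ n) (hna : n ≤ 2 * a) :
    ¬ (p : ℤ) ∣ (n.choose a : ℤ) - (n.choose (a + 1) : ℤ) := by
  rcases ha.eq_or_lt with rfl | hlt
  · have := hp.one_lt.ne'
    simpa [Int.natCast_dvd] using this
  intro h
  have hmul : ((n.choose a : ℤ) - (n.choose (a + 1) : ℤ)) * (a + 1) =
      ((n.choose a * (2 * a + 1 - n) : ℕ) : ℤ) := by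
    have := Nat.choose_succ_right_eq n a
    zify [ha] at this
    push_cast [show n ≤ 2 * a + 1 by omega]
    linear_combination -this
  have hdvd := hmul ▸ h.mul_right ((a : ℤ) + 1)
  rcases hp.dvd_mul.1 (Int.natCast_dvd_natCast.1 hdvd) with h | h
  · exact hp.not_dvd_choose_of_lt hn ha h
  · have := Nat.le_of_dvd (by omega) h
    omega

/-- Let `k ≥ 2` be an integer and `p` a prime with `p > 2k − 2`.  Then for every integer
`i` with `0 ≤ i ≤ k − 1`, the integer `binom(2k−2, k+i−1) − binom(2k−2, k+i)` is not
divisible by `p` (where `binom(2k−2, 2k−1)` is interpreted as `0`).  In other words,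
the coefficient of `x^{k+i} y^{k−1−i}` in `(x − y)(x + y)^{2k−2}` is nonzero in `ℤ/pℤ`. -/
theorem coeff_not_div (k p : ℕ) (hk : 2 ≤ k) (hp : p.Prime) (hpk : 2 * k - 2 < p) :
    ∀ i : ℕ, i ≤ k - 1 →
      (¬ (p : ℤ) ∣ (((2 * k - 2).choose (k + i - 1) : ℤ) - ((2 * k - 2).choose (k + i) : ℤ))) ∧
      MvPolynomial.coeff (Finsupp.single (0 : Fin 2) (k + i) + Finsupp.single 1 (k - 1 - i))
          ((X 0 - X 1) * (X 0 + X 1) ^ (2 * k - 2) : MvPolynomial (Fin 2) (ZMod p)) ≠ 0 := by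
  intro i hi
  have hdiv : ¬ (p : ℤ) ∣
      (((2 * k - 2).choose (k + i - 1) : ℤ) - ((2 * k - 2).choose (k + i) : ℤ)) := by
    have := hp.not_dvd_choose_sub_choose_succ hpk (a := k + i - 1) (by omega) (by omega)
    rwa [show k + i - 1 + 1 = k + i by omega] at this
  refine ⟨hdiv, fun h => hdiv ?_⟩
  have hcoeff := coeff_X_sub_X_mul_X_add_X_pow (R := ZMod p)
    (a := k + i - 1) (b := k - 1 - i) (n := 2 * k - 2) (by omega)
  rw [show k + i - 1 + 1 = k + i by omega, h] at hcoeff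
  rw [← CharP.intCast_eq_zero_iff (ZMod p) p]
  push_cast
  exact hcoeff.symm
end
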